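/- Let k, ℓ, t be positive integers with k even, set q := 2^k, Q := 2^ℓ, and suppose ord₂(ℓ) ≠ ord₂(k). Let D(X) := X^Q + X + 1 and B(X) := D(X) · (X^{2t} + X^t + 1). If r is a positive integer with gcd(r, q-1) = 1 and r ≡ Q + 1 + 2t (mod q+1), then X^r · B(X^{q-1}) is a permutation polynomial of F_{q²}. -/

import Mathlib

lemma aux_iter {F : Type} [Field F] (w : F) (m : ℕ) (h : w ^ (2 ^ m) = w⁻¹) (n : ℕ) :
    (Odd n → w ^ (2 ^ (m * n)) = w⁻¹) ∧ (Even n → w ^ (2 ^ (m * n)) = w) := by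
  induction n with
  | zero => simp
  | succ n ih =>
    have e : w ^ (2 ^ (m * (n + 1))) = (w ^ (2 ^ (m * n))) ^ (2 ^ m) := by
      rw [← pow_mul, ← pow_add]; rfl
    constructor
    · intro ho
      have : Even n := by
        rcases Nat.even_or_odd n with h | h
        · exact h
        · exact absurd ho (by simpa using h.add_one)
      rw [e, ih.2 this, h]
    · intro he
      have : Odd n := by
        rcases Nat.even_or_odd n with h | h
        · exact absurd he (by simpa using h.add_one)
        · exact h
      rw [e, ih.1 this, inv_pow, h, inv_inv]

lemma aux_iter_one {F : Type} [Field F] (w : F) (m : ℕ) (h : w ^ (2 ^ m) = w) (n : ℕ) :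
    w ^ (2 ^ (m * n)) = w := by
  induction n with
  | zero => simp
  | succ n ih =>
    have e : w ^ (2 ^ (m * (n + 1))) = (w ^ (2 ^ (m * n))) ^ (2 ^ m) := by
      rw [← pow_mul, ← pow_add]; rfl
    rw [e, ih, h]

lemma aux_inv {F : Type} [Field F] [CharP F 2] (w : F) (hw : w ≠ 0) (h : w = w⁻¹) : w = 1 := by
  have h2 : (2 : F) = 0 := by exact_mod_cast CharP.cast_eq_zero F 2
  have h1 : w * w = 1 := by
    nth_rewrite 2 [h]; exact mul_inv_cancel₀ hw
  have : (w - 1) ^ 2 = 0 := by linear_combination h1 + (1 - w) * h2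
  exact sub_eq_zero.mp (pow_eq_zero_iff (two_ne_zero) |>.mp this)

lemma aux_lt {F : Type} [Field F] [CharP F 2] (w : F) (hw : w ≠ 0) (k l : ℕ) (hk : 0 < k)
    (hl : 0 < l) (hlt : padicValNat 2 k < padicValNat 2 l)
    (h1 : w ^ (2 ^ k) = w⁻¹) (h2 : w ^ (2 ^ l) = w⁻¹) : w = 1 := by
  obtain ⟨a, k', hk', rfl⟩ := Nat.exists_eq_two_pow_mul_odd hk.ne'
  obtain ⟨b, l', hl', rfl⟩ := Nat.exists_eq_two_pow_mul_odd hl.ne'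
  have v : ∀ a c : ℕ, Odd c → padicValNat 2 (2 ^ a * c) = a := by
    intro a c hc
    rw [padicValNat.mul (by positivity) hc.pos.ne', padicValNat.prime_pow,
      padicValNat.eq_zero_of_not_dvd hc.not_two_dvd_nat, add_zero]
  rw [v a k' hk', v b l' hl'] at hlt
  obtain ⟨d, rfl⟩ := Nat.exists_eq_add_of_lt hlt
  have A := (aux_iter w _ h1 (2 ^ (d + 1) * l')).2
    ((Nat.even_pow.mpr ⟨even_two, by omega⟩).mul_right _)
  have B := (aux_iter w _ h2 k').1 hk'
  have e : 2 ^ a * k' * (2 ^ (d + 1) * l') = 2 ^ (a + d + 1) * l' * k' := by ring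
  rw [e, B] at A
  exact aux_inv w hw A.symm

/-- Corollary 5.1, case (4.2): `X^r B(X^{q-1})` with
`B = (X^Q+X+1)(X^{2t}+X^t+1)` is a permutation polynomial of `F_{q²}`. -/
theorem stmt_8 (k ℓ t : ℕ) (hk : 0 < k) (hl : 0 < ℓ) (ht : 0 < t) (hke : Even k)
    (q Q : ℕ) (hq : q = 2 ^ k) (hQ : Q = 2 ^ ℓ)
    (hord : padicValNat 2 ℓ ≠ padicValNat 2 k)
    (F : Type) [Field F] [Fintype F] (hF : Fintype.card F = q ^ 2)
    (D B : Polynomial F)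
    (hD : D = Polynomial.X ^ Q + Polynomial.X + 1)
    (hB : B = D * (Polynomial.X ^ (2 * t) + Polynomial.X ^ t + 1))
    (r : ℕ) (hr : 0 < r) (hrq : Nat.gcd r (q - 1) = 1)
    (hmod : r ≡ Q + 1 + 2 * t [MOD q + 1]) :
    Function.Bijective (fun c : F => c ^ r * B.eval (c ^ (q - 1))) := by
  classical
  have hchar : CharP F 2 := by
    obtain ⟨p, hp⟩ := CharP.exists F
    have hpp : p.Prime := CharP.char_is_prime F p
    obtain ⟨n, -, hn⟩ := FiniteField.card F p
    have : p ∣ 2 ^ (k * 2) := by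
      rw [pow_mul, ← hq, ← hF, hn]; exact dvd_pow_self _ n.pos.ne'
    have := (Nat.prime_dvd_prime_iff_eq hpp Nat.prime_two).mp (hpp.dvd_of_dvd_pow this)
    exact this ▸ hp
  have h2 : (2 : F) = 0 := by exact_mod_cast CharP.cast_eq_zero F 2
  haveI : Fact (Nat.Prime 2) := ⟨Nat.prime_two⟩
  have hq1 : 1 ≤ q := hq ▸ Nat.one_le_two_pow
  have frq : ∀ a b : F, (a + b) ^ q = a ^ q + b ^ q := by
    intro a b; rw [hq]; exact add_pow_char_pow a b _ _
  have frQ : ∀ a b : F, (a + b) ^ Q = a ^ Q + b ^ Q := by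
    intro a b; rw [hQ]; exact add_pow_char_pow a b _ _
  -- powers of two modulo three
  have four : ∀ n : ℕ, 4 ^ n % 3 = 1 := by
    intro n; rw [Nat.pow_mod]; simp
  have pe : ∀ n : ℕ, Even n → 2 ^ n % 3 = 1 := by
    rintro n ⟨m, rfl⟩
    rw [← two_mul, pow_mul]; exact four m
  have po : ∀ n : ℕ, Odd n → 2 ^ n % 3 = 2 := by
    rintro n ⟨m, rfl⟩
    rw [pow_succ, pow_mul]; have := four m; norm_num; omega
  have hq3 : q % 3 = 1 := hq ▸ pe k hke
  -- no cube roots of unity in mu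
  have nocube : ∀ z : F, z ^ (q + 1) = 1 → z ^ 2 + z + 1 ≠ 0 := by
    intro z hz h
    have z3 : z ^ 3 = 1 := by linear_combination (z - 1) * h
    have : z ^ (q + 1) = z ^ 2 := by
      have e : q + 1 = 3 * (q / 3) + 2 := by omega
      rw [e, pow_add, pow_mul, z3, one_pow, one_mul]
    rw [hz] at this
    have z1 : z = 0 := by linear_combination h + this - h2
    rw [z1] at z3; simp at z3
  obtain ⟨ω, hω⟩ : ∃ ω : F, ω ^ 2 + ω + 1 = 0 := by
    haveI : Fact (Nat.Prime 3) := ⟨Nat.prime_three⟩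
    have : 3 ∣ Fintype.card Fˣ := by
      rw [Fintype.card_units, hF]
      have : q ^ 2 % 3 = 1 := by rw [Nat.pow_mod, hq3]
      omega
    obtain ⟨u, hu⟩ := exists_prime_orderOf_dvd_card 3 this
    have u3 : (u : F) ^ 3 = 1 := by
      have := pow_orderOf_eq_one u
      rw [hu] at this
      have h := congrArg Units.val this
      rwa [Units.val_pow_eq_pow_val, Units.val_one] at h
    have u1 : (u : F) ≠ 1 := by
      intro h
      have : u = 1 := Units.ext h
      rw [this] at hu; simp at hu
    refine ⟨u, ?_⟩
    have : ((u : F) - 1) * ((u : F) ^ 2 + u + 1) = 0 := by linear_combination u3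
    exact (mul_eq_zero.mp this).resolve_left (sub_ne_zero.mpr u1)
  have w3 : ω ^ 3 = 1 := by linear_combination (ω - 1) * hω
  have wpow : ∀ n, ω ^ n = ω ^ (n % 3) := by
    intro n
    conv_lhs => rw [← Nat.div_add_mod n 3, pow_add, pow_mul, w3, one_pow, one_mul]
  have wq : ω ^ q = ω := by rw [wpow, hq3, pow_one]
  have mu0 : ∀ x : F, x ^ (q + 1) = 1 → x ≠ 0 := by
    rintro x hx rfl; simp at hx
  have hD0 : ∀ x : F, x ^ (q + 1) = 1 → x ^ Q + x + 1 ≠ 0 := by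
    intro x hx h
    have hxq : x ^ q * x = 1 := by rw [← pow_succ]; exact hx
    have h' : (x ^ Q + x + 1) ^ q = 0 := by rw [h]; simp; omega
    rw [frq, frq, one_pow] at h'
    have e : (x ^ q) ^ Q * x ^ Q = 1 := by rw [← mul_pow, hxq, one_pow]
    have e' : (x ^ Q) ^ q = (x ^ q) ^ Q := by rw [← pow_mul, ← pow_mul, mul_comm]
    rw [e'] at h'
    have hxQ : x ^ Q = x + 1 := by linear_combination h - (x + 1) * h2
    apply nocube x hx
    rw [hxQ] at e
    linear_combination x * (x + 1) * h' - x * e - (x + 1) * hxq - x * h2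
  have hT0 : ∀ x : F, x ^ (q + 1) = 1 → x ^ (2 * t) + x ^ t + 1 ≠ 0 := by
    intro x hx
    rw [mul_comm, pow_mul]
    apply nocube
    rw [← pow_mul, mul_comm, pow_mul, hx, one_pow]
  have Bev : ∀ x : F, B.eval x = (x ^ Q + x + 1) * (x ^ (2 * t) + x ^ t + 1) := by
    intro x; rw [hB, hD]; simp
  have hB0 : ∀ x : F, x ^ (q + 1) = 1 → B.eval x ≠ 0 := by
    intro x hx; rw [Bev]; exact mul_ne_zero (hD0 x hx) (hT0 x hx)
  have hmu : ∀ c : F, c ≠ 0 → (c ^ (q - 1)) ^ (q + 1) = 1 := by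
    intro c hc
    rw [← pow_mul]
    have : (q - 1) * (q + 1) = Fintype.card F - 1 := by
      rw [hF]; obtain ⟨m, rfl⟩ := Nat.exists_eq_add_of_le hq1
      have : (1 + m) ^ 2 = 1 + (1 + m - 1) * (1 + m + 1) := by
        simp; ring
      omega
    rw [this]; exact FiniteField.pow_card_sub_one_eq_one c hc
  have hG : ∀ c : F, c ≠ 0 → ∀ x, x = c ^ (q - 1) →
      (c ^ r * B.eval x) ^ (q - 1) * (x ^ Q + x + 1) = x * x ^ Q + x ^ Q + x := by
    intro c hc x hx
    have hxm : x ^ (q + 1) = 1 := hx ▸ hmu c hc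
    have hxq : x ^ q * x = 1 := by rw [← pow_succ]; exact hxm
    have e1 : (c ^ r) ^ (q - 1) = x ^ (Q + 1 + 2 * t) := by
      rw [← pow_mul, mul_comm, pow_mul, ← hx]
      exact pow_eq_pow_of_modEq hmod hxm
    have e2 : B.eval x ^ (q - 1) * B.eval x = B.eval x ^ q := by
      rw [← pow_succ]; congr 1; omega
    have eD : (x ^ Q + x + 1) ^ q * (x ^ Q * x) = x * x ^ Q + x ^ Q + x := by
      rw [frq, frq, one_pow]
      have e : (x ^ q) ^ Q * x ^ Q = 1 := by rw [← mul_pow, hxq, one_pow]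
      have e' : (x ^ Q) ^ q = (x ^ q) ^ Q := by rw [← pow_mul, ← pow_mul, mul_comm]
      rw [e']
      linear_combination x * e + x ^ Q * hxq
    have eT : (x ^ (2 * t) + x ^ t + 1) ^ q * x ^ (2 * t) = x ^ (2 * t) + x ^ t + 1 := by
      rw [mul_comm 2 t, pow_mul, frq, frq, one_pow]
      have e : (x ^ t) ^ q * x ^ t = 1 := by
        rw [← pow_mul, mul_comm t q, pow_mul, ← mul_pow, hxq, one_pow]
      rw [← pow_mul (x ^ t), mul_comm 2 q, pow_mul]
      linear_combination ((x ^ t) ^ q * x ^ t + 1 + x ^ t) * e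
    apply mul_right_cancel₀ (hT0 x hxm)
    rw [mul_pow, e1]
    rw [Bev, mul_pow _ _ q] at e2
    rw [Bev, pow_add, pow_add, pow_one]
    generalize (x ^ Q + x + 1) ^ q = A at *
    generalize (x ^ (2 * t) + x ^ t + 1) ^ q = C at *
    generalize ((x ^ Q + x + 1) * (x ^ (2 * t) + x ^ t + 1)) ^ (q - 1) = E at *
    linear_combination x ^ Q * x * x ^ (2 * t) * e2 + C * x ^ (2 * t) * eD +
      (x * x ^ Q + x ^ Q + x) * eT
  have hginj : ∀ x y s : F, x ^ (q + 1) = 1 → y ^ (q + 1) = 1 →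
      s * (x ^ Q + x + 1) = x * x ^ Q + x ^ Q + x →
      s * (y ^ Q + y + 1) = y * y ^ Q + y ^ Q + y → x = y := by
    intro x y s hx hy hsx hsy
    have hxq : x ^ q * x = 1 := by rw [← pow_succ]; exact hx
    have hyq : y ^ q * y = 1 := by rw [← pow_succ]; exact hy
    have nb : ∀ z : F, z ^ (q + 1) = 1 → z + ω ≠ 0 ∧ z + ω ^ 2 ≠ 0 := by
      intro z hz
      constructor
      · intro h
        apply nocube z hz
        have : z = ω := by linear_combination h - ω * h2
        rw [this, hω]
      · intro h
        apply nocube z hz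
        have : z = ω ^ 2 := by linear_combination h - ω ^ 2 * h2
        rw [this]; linear_combination (ω ^ 2 - ω + 1) * hω
    have key : ∀ z : F, s * (z ^ Q + z + 1) = z * z ^ Q + z ^ Q + z →
        (s + ω) * (z ^ Q + z + 1) = (z ^ Q + ω ^ 2) * (z + ω ^ 2) ∧
        (s + ω ^ 2) * (z ^ Q + z + 1) = (z ^ Q + ω) * (z + ω) := by
      intro z hz
      generalize z ^ Q = Z at *
      constructor
      · linear_combination hz + (Z + z) * (hω - ω ^ 2 * h2) - ω * w3
      · linear_combination hz + (Z + z) * (hω - ω * h2)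
    obtain ⟨kx1, kx2⟩ := key x hsx
    obtain ⟨ky1, ky2⟩ := key y hsy
    obtain ⟨bx, ax⟩ := nb x hx
    obtain ⟨by', ay⟩ := nb y hy
    have hDx := hD0 x hx
    have hDy := hD0 y hy
    have hu0 : (x + ω ^ 2) * (y + ω) ≠ 0 := mul_ne_zero ax by'
    have hv0 : (x + ω) * (y + ω ^ 2) ≠ 0 := mul_ne_zero bx ay
    have cross : (x ^ Q + ω ^ 2) * (x + ω ^ 2) * ((y ^ Q + ω) * (y + ω)) =
        (x ^ Q + ω) * (x + ω) * ((y ^ Q + ω ^ 2) * (y + ω ^ 2)) := by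
      rw [← kx1, ← kx2, ← ky1, ← ky2]; ring
    have hqq : ((x + ω ^ 2) * (y + ω)) ^ q * ((x + ω ^ 2) * (y + ω)) =
        ((x + ω) * (y + ω ^ 2)) ^ q * ((x + ω) * (y + ω ^ 2)) := by
      have w2q : (ω ^ 2) ^ q = ω ^ 2 := by rw [← pow_mul, mul_comm, pow_mul, wq]
      simp only [mul_pow, frq, wq]
      rw [w2q]
      apply mul_right_cancel₀ (mul_ne_zero (mu0 x hx) (mu0 y hy))
      have a1 : (x ^ q + ω ^ 2) * x = ω ^ 2 * (x + ω) := by linear_combination hxq - w3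
      have a2 : (y ^ q + ω ^ 2) * y = ω ^ 2 * (y + ω) := by linear_combination hyq - w3
      have b1 : (x ^ q + ω) * x = ω * (x + ω ^ 2) := by linear_combination hxq - w3
      have b2 : (y ^ q + ω) * y = ω * (y + ω ^ 2) := by linear_combination hyq - w3
      calc _ = ((x ^ q + ω ^ 2) * x) * ((y ^ q + ω) * y) * ((x + ω ^ 2) * (y + ω)) := by ring
        _ = ((x ^ q + ω) * x) * ((y ^ q + ω ^ 2) * y) * ((x + ω) * (y + ω ^ 2)) := by
          rw [a1, b2, b1, a2]; ring
        _ = _ := by ring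
    have hfin : (x + ω ^ 2) * (y + ω) = (x + ω) * (y + ω ^ 2) → x = y := by
      intro h
      have : (x - y) = 0 := by
        linear_combination (x - y) * hω - h - ω ^ 2 * (x - y) * h2 + 0 * h2
      exact sub_eq_zero.mp this
    apply hfin
    set u := (x + ω ^ 2) * (y + ω) with hu
    set v := (x + ω) * (y + ω ^ 2) with hv
    have hw0 : u / v ≠ 0 := div_ne_zero hu0 hv0
    have hwk : (u / v) ^ (2 ^ k) = (u / v)⁻¹ := by
      rw [← hq]
      apply eq_inv_of_mul_eq_one_left
      rw [div_pow, div_mul_div_comm, hqq]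
      exact div_self (mul_ne_zero (pow_ne_zero _ hv0) hv0)
    suffices hw1 : u / v = 1 from (div_eq_one_iff_eq hv0).mp hw1
    rcases Nat.even_or_odd ℓ with he | ho
    · have wQ : ω ^ Q = ω := by rw [wpow, hQ, pe ℓ he, pow_one]
      have w2Q : (ω ^ 2) ^ Q = ω ^ 2 := by rw [← pow_mul, mul_comm, pow_mul, wQ]
      have hQQ : u ^ Q * u = v ^ Q * v := by
        rw [hu, hv]; simp only [mul_pow, frQ, wQ]; rw [w2Q]
        linear_combination cross
      have hwl : (u / v) ^ (2 ^ ℓ) = (u / v)⁻¹ := by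
        rw [← hQ]
        apply eq_inv_of_mul_eq_one_left
        rw [div_pow, div_mul_div_comm, hQQ]
        exact div_self (mul_ne_zero (pow_ne_zero _ hv0) hv0)
      rcases lt_or_gt_of_ne hord with h | h
      · exact aux_lt _ hw0 ℓ k hl hk h hwl hwk
      · exact aux_lt _ hw0 k ℓ hk hl h hwk hwl
    · have wQ : ω ^ Q = ω ^ 2 := by rw [wpow, hQ, po ℓ ho]
      have w2Q : (ω ^ 2) ^ Q = ω := by
        rw [← pow_mul, mul_comm, pow_mul, wQ]; linear_combination ω * w3
      have hQQ : u ^ Q * v = u * v ^ Q := by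
        rw [hu, hv]; simp only [mul_pow, frQ, wQ]; rw [w2Q]
        linear_combination -cross
      have hwl : (u / v) ^ (2 ^ ℓ) = u / v := by
        rw [← hQ, div_pow, div_eq_div_iff (pow_ne_zero _ hv0) hv0, hQQ]
      have A := aux_iter_one _ ℓ hwl k
      have A' := (aux_iter _ k hwk ℓ).1 ho
      rw [mul_comm, A'] at A
      exact aux_inv _ hw0 A.symm
  apply Finite.injective_iff_bijective.mp
  intro c d hcd
  simp only at hcd
  have hne : ∀ c : F, c ≠ 0 → c ^ r * B.eval (c ^ (q - 1)) ≠ 0 := fun c hc =>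
    mul_ne_zero (pow_ne_zero _ hc) (hB0 _ (hmu c hc))
  by_cases hc : c = 0
  · by_contra hd
    have hd' : d ≠ 0 := fun h => hd (hc.trans h.symm)
    apply hne d hd'
    rw [← hcd, hc, zero_pow hr.ne', zero_mul]
  by_cases hd : d = 0
  · exfalso
    apply hne c hc
    rw [hcd, hd, zero_pow hr.ne', zero_mul]
  have h1 := hG c hc _ rfl
  have h3 := hG d hd _ rfl
  rw [← hcd] at h3
  have hxy : c ^ (q - 1) = d ^ (q - 1) := hginj _ _ _ (hmu c hc) (hmu d hd) h1 h3
  rw [← hxy] at hcd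
  have hcr : c ^ r = d ^ r := mul_right_cancel₀ (hB0 _ (hmu c hc)) hcd
  have p1 : (c / d) ^ r = 1 := by rw [div_pow, hcr, div_self (pow_ne_zero _ hd)]
  have p2 : (c / d) ^ (q - 1) = 1 := by rw [div_pow, hxy, div_self (pow_ne_zero _ hd)]
  have p3 : orderOf (c / d) ∣ 1 := hrq ▸ Nat.dvd_gcd (orderOf_dvd_of_pow_eq_one p1)
    (orderOf_dvd_of_pow_eq_one p2)
  have p4 : c / d = 1 := orderOf_eq_one_iff.mp (Nat.dvd_one.mp p3)
  exact (div_eq_one_iff_eq hd).mp p4
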